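/- arXiv:cs/0701071 — 2 statements merged into one kernel-verified Lean document; each statement's English description precedes it below -/
import Mathlib

section
/- There is a constant c > 0 such that for every integer k ≥ 2, every finite additive abelian group H of order n ≥ c·2^k, and every set S ⊆ H \ {0} with |S| = k, the Cayley wiring on H with connection set S is not stable for the uniform (n,k)-BDNF game. -/
namespace BDNF

variable {V : Type} [DecidableEq V]

/-- `connIn s m v u` : there is a directed path with at most `m` edges from `v`
to `u` in the directed graph defined by the wiring `s`. -/
def connIn (s : V → Finset V) : ℕ → V → V → Prop
  | 0, v, u => v = u
  | m + 1, v, u => v = u ∨ ∃ w ∈ s v, connIn s m w u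

/-- Directed hop distance from `v` to `u`, with disconnection penalty `M`. -/
noncomputable def distW (s : V → Finset V) (M : ℕ) (v u : V) : ℕ := by
  classical exact if h : ∃ m, connIn s m v u then Nat.find h else M

/-- Cost of node `v` in the uniform game: the sum of its distances to all
other nodes. -/
noncomputable def cost [Fintype V] (s : V → Finset V) (M : ℕ) (v : V) : ℕ :=
  ∑ u ∈ Finset.univ.filter (fun u => u ≠ v), distW s M v u

/-- `s` is a wiring with out-degree bound `k`: every node links to at most `k`
other nodes. -/
def IsWiring (k : ℕ) (s : V → Finset V) : Prop :=
  ∀ v, v ∉ s v ∧ (s v).card ≤ k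

/-- `s` is stable (a pure Nash equilibrium) for the uniform game: no node can
strictly decrease its cost by rewiring its own out-links. -/
def Stable [Fintype V] (k M : ℕ) (s : V → Finset V) : Prop :=
  ∀ (v : V) (t : Finset V), v ∉ t → t.card ≤ k →
    cost s M v ≤ cost (Function.update s v t) M v

/-- The Cayley wiring on an additive group `H` with connection set `S`:
node `v` links to `v + a` for each `a ∈ S`. -/
def cayley {H : Type} [AddCommGroup H] [DecidableEq H] (S : Finset H) :
    H → Finset H :=
  fun v => S.image (fun a => v + a)

section General

variable {V : Type} {s : V → Finset V}

theorem connIn_succ {m : ℕ} {v u : V} (h : connIn s m v u) : connIn s (m + 1) v u := by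
  induction m generalizing v with
  | zero => exact Or.inl h
  | succ m ih =>
    rcases h with h | ⟨w, hw, h⟩
    · exact Or.inl h
    · exact Or.inr ⟨w, hw, ih h⟩

theorem connIn_mono {m m' : ℕ} (hm : m ≤ m') {v u : V} (h : connIn s m v u) :
    connIn s m' v u := by
  induction hm with
  | refl => exact h
  | step _ ih => exact connIn_succ ih

theorem connIn_refl (m : ℕ) (v : V) : connIn s m v v :=
  connIn_mono (Nat.zero_le m) (show connIn s 0 v v from rfl)

theorem connIn_trans {m m' : ℕ} {v u w : V} (h : connIn s m v u) (h' : connIn s m' u w) :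
    connIn s (m + m') v w := by
  induction m generalizing v with
  | zero =>
    have : v = u := h
    subst this
    exact connIn_mono (by omega) h'
  | succ m ih =>
    rcases h with h | ⟨x, hx, h⟩
    · subst h
      exact connIn_mono (by omega) h'
    · rw [Nat.succ_add]
      exact Or.inr ⟨x, hx, ih h⟩

theorem connIn_cons {m : ℕ} {v x u : V} (hx : x ∈ s v) (h : connIn s m x u) :
    connIn s (m + 1) v u :=
  Or.inr ⟨x, hx, h⟩

theorem connIn_snoc {m : ℕ} {v u x : V} (h : connIn s m v u) (hx : x ∈ s u) :
    connIn s (m + 1) v x :=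
  connIn_trans h (connIn_cons hx (connIn_refl 0 x))

theorem distW_le (M : ℕ) {m : ℕ} {v u : V} (h : connIn s m v u) : distW s M v u ≤ m := by
  classical
  unfold distW
  rw [dif_pos ⟨m, h⟩]
  exact Nat.find_min' _ h

theorem connIn_distW (M : ℕ) {v u : V} (h : ∃ m, connIn s m v u) :
    connIn s (distW s M v u) v u := by
  classical
  unfold distW
  rw [dif_pos h]
  exact Nat.find_spec h

theorem distW_eq_penalty (M : ℕ) {v u : V} (h : ¬ ∃ m, connIn s m v u) :
    distW s M v u = M := by
  classical
  unfold distW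
  rw [dif_neg h]

theorem connIn_succ_snoc {m : ℕ} {v u : V} (h : connIn s (m + 1) v u) :
    connIn s m v u ∨ ∃ x, connIn s m v x ∧ u ∈ s x := by
  induction m generalizing v with
  | zero =>
    rcases h with h | ⟨w, hw, h⟩
    · exact Or.inl h
    · have : w = u := h
      subst this
      exact Or.inr ⟨v, rfl, hw⟩
  | succ m ih =>
    rcases h with h | ⟨w, hw, h⟩
    · exact Or.inl (Or.inl h)
    · rcases ih h with h | ⟨x, hx, hu⟩
      · exact Or.inl (connIn_cons hw h)
      · exact Or.inr ⟨x, connIn_cons hw hx, hu⟩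

theorem exists_distW_eq (M : ℕ) {i : ℕ} {v u : V} (h : ∃ m, connIn s m v u)
    (hi : i ≤ distW s M v u) : ∃ x, distW s M v x = i := by
  suffices key : ∀ j u, (∃ m, connIn s m v u) → distW s M v u = i + j →
      ∃ x, distW s M v x = i from key (distW s M v u - i) u h (by omega)
  intro j
  induction j with
  | zero => exact fun u _ hd => ⟨u, hd⟩
  | succ j ih =>
    intro u hu hd
    have hc := connIn_distW M hu
    rw [hd, ← Nat.add_assoc] at hc
    rcases connIn_succ_snoc hc with hc | ⟨x, hx, hxu⟩
    · have := distW_le M hc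
      omega
    · refine ih x ⟨_, hx⟩ (le_antisymm (distW_le M hx) ?_)
      have := distW_le M (connIn_snoc (connIn_distW M ⟨_, hx⟩) hxu)
      omega

theorem distW_lt_card [Fintype V] (M : ℕ) {v u : V} (h : ∃ m, connIn s m v u) :
    distW s M v u < Fintype.card V := by
  have hsub : Finset.range (distW s M v u + 1) ⊆ Finset.univ.image (distW s M v) := by
    intro i hi
    rw [Finset.mem_range] at hi
    obtain ⟨x, hx⟩ := exists_distW_eq M h (i := i) (by omega)
    exact Finset.mem_image.2 ⟨x, Finset.mem_univ _, hx⟩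
  have h1 := (Finset.card_le_card hsub).trans Finset.card_image_le
  rw [Finset.card_range, Finset.card_univ] at h1
  omega

variable [DecidableEq V]

/-- A path that is too short to return to `v₀` survives rewiring of `v₀`. -/
theorem connIn_update_of_far {v₀ : V} {t : Finset V} {m : ℕ} {w u : V}
    (hfar : ∀ j < m, ¬ connIn s j w v₀) (h : connIn s m w u) :
    connIn (Function.update s v₀ t) m w u := by
  induction m generalizing w with
  | zero => exact h
  | succ m ih =>
    rcases h with h | ⟨x, hx, h⟩
    · exact Or.inl h
    · have hw : w ≠ v₀ := fun e => hfar 0 (by omega) e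
      refine Or.inr ⟨x, by rwa [Function.update_of_ne hw], ih (fun j hj hc => ?_) h⟩
      exact hfar (j + 1) (by omega) (connIn_cons hx hc)

/-- A path survives rewiring of `v₀`, unless `v₀` reaches its endpoint at least as fast. -/
theorem connIn_update_or {v₀ : V} (t : Finset V) {m : ℕ} {w u : V} (h : connIn s m w u) :
    connIn (Function.update s v₀ t) m w u ∨ connIn s m v₀ u := by
  induction m generalizing w with
  | zero => exact Or.inl h
  | succ m ih =>
    by_cases hw : w = v₀
    · subst hw
      exact Or.inr h
    · rcases h with h | ⟨x, hx, h⟩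
      · exact Or.inl (Or.inl h)
      · rcases ih h with h' | h'
        · exact Or.inl (Or.inr ⟨x, by rwa [Function.update_of_ne hw], h'⟩)
        · exact Or.inr (connIn_succ h')

end General

section Cayley

variable {H : Type} [AddCommGroup H] [DecidableEq H] {S : Finset H}

theorem mem_cayley {v u : H} : u ∈ cayley S v ↔ u - v ∈ S := by
  simp only [cayley, Finset.mem_image]
  constructor
  · rintro ⟨a, ha, rfl⟩
    simpa using ha
  · exact fun h => ⟨_, h, by abel⟩

theorem connIn_cayley_iff {m : ℕ} {v u : H} :
    connIn (cayley S) m v u ↔ connIn (cayley S) m 0 (u - v) := by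
  suffices key : ∀ (x : H) {v u : H}, connIn (cayley S) m v u →
      connIn (cayley S) m (v + x) (u + x) by
    constructor
    · intro h
      simpa [sub_eq_add_neg] using key (-v) h
    · intro h
      simpa using key v h
  intro x
  induction m with
  | zero =>
    intro v u h
    have : v = u := h
    subst this
    exact connIn_refl 0 _
  | succ m ih =>
    rintro v u (h | ⟨w, hw, h⟩)
    · exact Or.inl (by rw [h])
    · refine Or.inr ⟨w + x, ?_, ih h⟩
      rw [mem_cayley] at hw ⊢
      simpa using hw

/-- `u` is reachable from `0` in the Cayley graph. -/
def Reach (S : Finset H) (u : H) : Prop := ∃ m, connIn (cayley S) m 0 u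

/-- The distance from `0` to `v` in the Cayley graph. -/
noncomputable def wordLen (S : Finset H) (M : ℕ) (v : H) : ℕ := distW (cayley S) M 0 v

variable {M : ℕ}

theorem connIn_wordLen {v u : H} (h : Reach S (u - v)) :
    connIn (cayley S) (wordLen S M (u - v)) v u :=
  connIn_cayley_iff.2 (connIn_distW M h)

theorem wordLen_le {m : ℕ} {v u : H} (h : connIn (cayley S) m v u) :
    wordLen S M (u - v) ≤ m :=
  distW_le M (connIn_cayley_iff.1 h)

theorem wordLen_le_of_connIn_zero {m : ℕ} {u : H} (h : connIn (cayley S) m 0 u) :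
    wordLen S M u ≤ m :=
  distW_le M h

theorem connIn_zero_wordLen {u : H} (h : Reach S u) :
    connIn (cayley S) (wordLen S M u) 0 u :=
  connIn_distW M h

theorem Reach.add {x y : H} (hx : Reach S x) (hy : Reach S y) : Reach S (x + y) := by
  obtain ⟨m, hm⟩ := hx
  obtain ⟨m', hm'⟩ := hy
  refine ⟨m + m', connIn_trans hm (connIn_cayley_iff.2 ?_)⟩
  simpa using hm'

theorem reach_zero : Reach S (0 : H) := ⟨0, rfl⟩

theorem connIn_one_of_mem {a : H} (ha : a ∈ S) : connIn (cayley S) 1 0 a :=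
  connIn_cons (mem_cayley.2 (by simpa using ha)) (connIn_refl 0 a)

theorem reach_of_mem {a : H} (ha : a ∈ S) : Reach S a := ⟨1, connIn_one_of_mem ha⟩

theorem wordLen_zero : wordLen S M (0 : H) = 0 :=
  Nat.le_zero.1 (wordLen_le_of_connIn_zero (m := 0) rfl)

theorem wordLen_of_mem_le {a : H} (ha : a ∈ S) : wordLen S M a ≤ 1 :=
  wordLen_le_of_connIn_zero (connIn_one_of_mem ha)

theorem eq_zero_of_wordLen {v : H} (hv : Reach S v) (h : wordLen S M v = 0) : v = 0 := by
  have := connIn_zero_wordLen (M := M) hv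
  rw [h] at this
  exact Eq.symm this

theorem wordLen_add_le {x y : H} (hx : Reach S x) (hy : Reach S y) :
    wordLen S M (x + y) ≤ wordLen S M x + wordLen S M y := by
  refine wordLen_le_of_connIn_zero (connIn_trans (connIn_zero_wordLen hx) ?_)
  rw [connIn_cayley_iff]
  simpa using connIn_zero_wordLen (M := M) hy

theorem exists_wordLen_sub {m : ℕ} {v : H} (hv : Reach S v) (h : wordLen S M v = m + 1) :
    ∃ a ∈ S, Reach S (v - a) ∧ wordLen S M (v - a) = m := by
  have hc := connIn_zero_wordLen (M := M) hv
  rw [h] at hc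
  rcases hc with hc | ⟨a, ha, hc⟩
  · rw [← hc, wordLen_zero] at h
    omega
  · have ha' : a ∈ S := by simpa using mem_cayley.1 ha
    have hr : Reach S (v - a) := ⟨m, connIn_cayley_iff.1 hc⟩
    refine ⟨a, ha', hr, le_antisymm (wordLen_le hc) ?_⟩
    have h1 := wordLen_add_le (M := M) hr (reach_of_mem ha')
    have h2 := wordLen_of_mem_le (M := M) ha'
    rw [sub_add_cancel] at h1
    omega

theorem exists_wordLen_split {i j : ℕ} {v : H} (hv : Reach S v) (h : wordLen S M v = i + j) :
    ∃ q, Reach S q ∧ Reach S (v - q) ∧ wordLen S M q = i ∧ wordLen S M (v - q) = j := by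
  induction j generalizing v with
  | zero => exact ⟨v, hv, by simpa using reach_zero, by simpa using h, by simpa using wordLen_zero⟩
  | succ j ih =>
    obtain ⟨a, ha, hr, hl⟩ := exists_wordLen_sub (m := i + j) hv (by omega)
    obtain ⟨q, hq, hq', h1, h2⟩ := ih hr hl
    have e : v - q = (v - a - q) + a := by abel
    have hr' : Reach S (v - q) := e ▸ hq'.add (reach_of_mem ha)
    refine ⟨q, hq, hr', h1, ?_⟩
    have h3 := wordLen_add_le (M := M) hq' (reach_of_mem ha)
    have h4 := wordLen_of_mem_le (M := M) ha
    have h5 := wordLen_add_le (M := M) hq hr'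
    rw [← e] at h3
    rw [add_sub_cancel] at h5
    omega

theorem cost_cayley_zero [Fintype H] :
    cost (cayley S) M 0 = ∑ u ∈ Finset.univ.filter (fun u : H => u ≠ 0), wordLen S M u := rfl

theorem sum_ne_zero_add [Fintype H] (f : H → ℕ) :
    ∑ u ∈ Finset.univ.filter (fun u : H => u ≠ 0), f u + f 0 = ∑ u, f u := by
  rw [Finset.filter_ne', Finset.sum_erase_add _ _ (Finset.mem_univ 0)]

/-- If every node that `0` reaches lies within distance `wordLen v`, a single link from `0` to
`-v` keeps all of them reachable. -/
theorem connIn_update_of_neg_mem {v u : H} {t : Finset H} (ht : -v ∈ t)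
    (hv : Reach S v) (hmax : ∀ u, Reach S u → wordLen S M u ≤ wordLen S M v)
    (hu : Reach S u) :
    connIn (Function.update (cayley S) 0 t) (wordLen S M (u + v) + 1) 0 u := by
  have h := connIn_wordLen (M := M) (v := -v) (u := u) (by simpa using hu.add hv)
  rw [sub_neg_eq_add] at h
  refine connIn_cons (x := -v) (by simpa using ht) (connIn_update_of_far (fun j hj hc => ?_) h)
  have h1 := wordLen_le (M := M) hc
  have h2 := hmax _ (hu.add hv)
  simp only [zero_sub, neg_neg] at h1
  omega

theorem exists_max_wordLen [Fintype H] (S : Finset H) (M : ℕ) :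
    ∃ v, Reach S v ∧ ∀ u, Reach S u → wordLen S M u ≤ wordLen S M v := by
  classical
  obtain ⟨v, hv, h⟩ := Finset.exists_max_image (Finset.univ.filter (Reach S)) (wordLen S M)
    ⟨0, by simpa using reach_zero⟩
  exact ⟨v, by simpa using hv, fun u hu => h u (by simpa using hu)⟩

theorem wordLen_pos_of_max [Fintype H] (hS0 : (0 : H) ∉ S) (hS : S.Nonempty) {v : H}
    (hmax : ∀ u, Reach S u → wordLen S M u ≤ wordLen S M v) : 0 < wordLen S M v := by
  obtain ⟨a, ha⟩ := hS
  have h := hmax a (reach_of_mem ha)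
  rcases Nat.eq_zero_or_pos (wordLen S M a) with h0 | h0
  · exact absurd (eq_zero_of_wordLen (reach_of_mem ha) h0 ▸ ha) hS0
  · omega

/-- A stable Cayley graph is strongly connected. -/
theorem Stable.reach [Fintype H] {k : ℕ} (hk : 2 ≤ k) (hS0 : (0 : H) ∉ S) (hSk : S.card = k)
    (hM : Fintype.card H ^ 2 < M) (hst : Stable k M (cayley S)) (h : H) : Reach S h := by
  classical
  by_contra hh
  obtain ⟨v, hv, hmax⟩ := exists_max_wordLen S M
  have hpos := wordLen_pos_of_max hS0 (Finset.card_pos.1 (by omega)) hmax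
  have hv0 : v ≠ 0 := by
    rintro rfl
    rw [wordLen_zero] at hpos
    omega
  have hh0 : h ≠ 0 := by
    rintro rfl
    exact hh reach_zero
  have hle := hst 0 {-v, h} (by simp [hv0, hh0.symm])
    (Finset.card_le_two.trans hk)
  rw [cost_cayley_zero] at hle
  unfold cost at hle
  set n := Fintype.card H with hn
  set s' := Function.update (cayley S) 0 {-v, h}
  have hlt : wordLen S M v < n := distW_lt_card M hv
  have hpt : ∀ u ∈ Finset.univ.filter (fun u : H => u ≠ 0),
      distW s' M 0 u + (if u = h then M else 0) ≤ wordLen S M u + n := by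
    intro u _
    by_cases hu : Reach S u
    · rw [if_neg (by rintro rfl; exact hh hu)]
      have h1 := distW_le M (connIn_update_of_neg_mem (t := {-v, h}) (by simp) hv hmax hu)
      have h2 := hmax _ (hu.add hv)
      change distW s' M 0 u ≤ _ at h1
      omega
    · have hM' : wordLen S M u = M := distW_eq_penalty M hu
      split_ifs with he
      · subst he
        have : connIn s' 1 0 u := connIn_cons (x := u) (by simp [s']) (connIn_refl 0 u)
        have := distW_le M this
        omega
      · by_cases hu' : ∃ m, connIn s' m 0 u
        · have hle' : distW s' M 0 u ≤ M := by
            have := distW_lt_card M hu'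
            nlinarith
          omega
        · have := distW_eq_penalty M hu'
          omega
  have hsum := Finset.sum_le_sum hpt
  rw [Finset.sum_add_distrib, Finset.sum_add_distrib, Finset.sum_ite_eq',
    if_pos (by simpa using hh0), Finset.sum_const, smul_eq_mul] at hsum
  have hcard : (Finset.univ.filter (fun u : H => u ≠ 0)).card ≤ n := Finset.card_le_univ _
  have := Nat.mul_le_mul_right n hcard
  nlinarith

/-- In a stable Cayley graph the square of the diameter is at most four times the order. -/
theorem Stable.sq_wordLen_le [Fintype H] {k : ℕ} (hk : 2 ≤ k) (hst : Stable k M (cayley S))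
    (hr : ∀ u, Reach S u) {v : H} (hmax : ∀ u, wordLen S M u ≤ wordLen S M v)
    (hpos : 0 < wordLen S M v) : wordLen S M v ^ 2 ≤ 4 * Fintype.card H := by
  classical
  set D := wordLen S M v with hD
  set n := Fintype.card H with hn
  obtain ⟨m, hm⟩ : ∃ m, m = D / 2 := ⟨_, rfl⟩
  obtain ⟨q, -, -, hq, hvq⟩ :=
    exists_wordLen_split (M := M) (i := m) (j := D - m) (hr v) (by omega)
  set p := q - v with hp
  have hv0 : v ≠ 0 := by
    rintro rfl
    rw [wordLen_zero] at hD
    omega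
  have hp0 : p ≠ 0 := by
    intro h
    have : v - q = 0 := by rw [← neg_sub, ← hp, h, neg_zero]
    rw [this, wordLen_zero] at hvq
    omega
  have hle := hst 0 {-v, p} (by simp [hv0, hp0.symm]) (Finset.card_le_two.trans hk)
  rw [cost_cayley_zero] at hle
  unfold cost at hle
  set s' := Function.update (cayley S) 0 {-v, p}
  -- the nodes to which the link to `p` opens a shortcut of `m` steps
  set P := Finset.univ.filter fun u : H =>
    u ≠ 0 ∧ wordLen S M (u - p) + m = wordLen S M (u + v) with hP
  have hpt : ∀ u ∈ Finset.univ.filter (fun u : H => u ≠ 0),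
      distW s' M 0 u + (if u ∈ P then m else 0) ≤ wordLen S M (u + v) + 1 := by
    intro u _
    split_ifs with hu
    · rw [hP, Finset.mem_filter] at hu
      obtain ⟨-, hu0, hu⟩ := hu
      have h := connIn_wordLen (M := M) (hr (u - p))
      have hlt : wordLen S M (u + v) ≤ D := hmax _
      have h' : connIn s' (wordLen S M (u - p)) p u := by
        refine connIn_update_of_far (fun j hj hc => ?_) h
        have h1 := wordLen_le (M := M) hc
        rw [zero_sub, hp, neg_sub] at h1
        omega
      have := distW_le M (connIn_cons (s := s') (v := 0) (by simp [s']) h')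
      omega
    · exact distW_le M (connIn_update_of_neg_mem (by simp) (hr v) (fun u _ => hmax u) (hr u))
  have hcardP : D - m - 1 ≤ P.card := by
    have hsub : Finset.Ioo m D ⊆ P.image fun u => wordLen S M (u + v) := by
      intro i hi
      rw [Finset.mem_Ioo] at hi
      obtain ⟨r, -, -, h1, h2⟩ :=
        exists_wordLen_split (M := M) (i := i - m) (j := D - i) (hr (v - q)) (by omega)
      have h3 := wordLen_add_le (M := M) (hr q) (hr r)
      have h4 := wordLen_add_le (M := M) (hr (q + r)) (hr (v - q - r))
      rw [show q + r + (v - q - r) = v by abel] at h4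
      have e1 : p + r + v = q + r := by rw [hp]; abel
      have e2 : p + r - p = r := by abel
      refine Finset.mem_image.2 ⟨p + r, ?_, by rw [e1]; omega⟩
      rw [hP, Finset.mem_filter, e1, e2]
      refine ⟨Finset.mem_univ _, fun h0 => ?_, by omega⟩
      rw [h0, zero_add] at e1
      rw [← e1] at h3
      omega
    have := (Finset.card_le_card hsub).trans Finset.card_image_le
    rw [Nat.card_Ioo] at this
    omega
  have hsum := Finset.sum_le_sum hpt
  have hPsum : ∑ u ∈ Finset.univ.filter (fun u : H => u ≠ 0), (if u ∈ P then m else 0)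
      = P.card * m := by
    rw [← Finset.sum_filter, Finset.sum_const, smul_eq_mul]
    congr 2
    ext u
    simp only [hP, Finset.mem_filter, Finset.mem_univ, true_and]
    tauto
  rw [Finset.sum_add_distrib, hPsum, Finset.sum_add_distrib, Finset.sum_const, smul_eq_mul,
    mul_one] at hsum
  have hcard : (Finset.univ.filter (fun u : H => u ≠ 0)).card + 1 = n := by
    rw [Finset.filter_ne', Finset.card_erase_of_mem (Finset.mem_univ _), Finset.card_univ]
    have : 0 < Fintype.card H := Fintype.card_pos
    omega
  have h1 := sum_ne_zero_add fun u : H => wordLen S M (u + v)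
  have h2 := sum_ne_zero_add fun u : H => wordLen S M u
  have h3 : ∑ u : H, wordLen S M (u + v) = ∑ u : H, wordLen S M u :=
    Equiv.sum_comp (Equiv.addRight v) (wordLen S M)
  simp only [zero_add] at h1
  rw [wordLen_zero] at h2
  have h4 : (D - m - 1) * m + D + 1 ≤ n := by
    have := Nat.mul_le_mul_right m hcardP
    omega
  rcases Nat.even_or_odd' D with ⟨d, h | h⟩
  · obtain rfl : m = d := by omega
    obtain ⟨e, rfl⟩ : ∃ e, m = e + 1 := ⟨m - 1, by omega⟩
    rw [h, show 2 * (e + 1) - (e + 1) - 1 = e by omega] at h4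
    rw [h]
    nlinarith
  · obtain rfl : m = d := by omega
    rw [h, show 2 * m + 1 - m - 1 = m by omega] at h4
    rw [h]
    nlinarith

/-- The nodes having a shortest representation that uses the generator `a` at least twice. -/
noncomputable def doubled [Fintype H] (S : Finset H) (M : ℕ) (a : H) : Finset H :=
  Finset.univ.filter fun v => wordLen S M (v - a - a) + 2 = wordLen S M v

theorem mem_doubled [Fintype H] {a v : H} :
    v ∈ doubled S M a ↔ wordLen S M (v - a - a) + 2 = wordLen S M v := by
  simp [doubled]

theorem Stable.card_doubled_le [Fintype H] {k : ℕ} (hk : 2 ≤ k) (hS0 : (0 : H) ∉ S)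
    (hSk : S.card = k) (hst : Stable k M (cayley S)) (hr : ∀ u, Reach S u) {D : ℕ}
    (hmax : ∀ u, wordLen S M u ≤ D) {a : H} (ha : a ∈ S) : (doubled S M a).card ≤ D := by
  classical
  by_cases haa : a + a = 0
  · have : doubled S M a = ∅ := by
      ext v
      rw [mem_doubled, sub_sub, haa, sub_zero]
      simp
    simp [this]
  have ha0 : a ≠ 0 := fun h => hS0 (h ▸ ha)
  have hle := hst 0 (insert (a + a) (S.erase a))
    (by simp [Ne.symm haa, hS0])
    ((Finset.card_insert_le _ _).trans (by rw [Finset.card_erase_of_mem ha]; omega))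
  rw [cost_cayley_zero] at hle
  unfold cost at hle
  set s' := Function.update (cayley S) 0 (insert (a + a) (S.erase a)) with hs'
  have hdouble : ∀ v ∈ doubled S M a, connIn s' (wordLen S M (v - a - a) + 1) 0 v := by
    intro v hv
    rw [mem_doubled] at hv
    have h := connIn_wordLen (M := M) (v := a + a) (u := v) (hr _)
    rw [← sub_sub] at h
    rcases connIn_update_or (insert (a + a) (S.erase a)) (v₀ := 0) h with h | h
    · exact connIn_cons (s := s') (v := 0) (by simp [s']) h
    · have := wordLen_le_of_connIn_zero (M := M) h
      omega
  have hother : ∀ v, v ≠ 0 → v ≠ a → connIn s' (wordLen S M v) 0 v := by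
    intro v hv0 hva
    by_cases hv : v ∈ doubled S M a
    · exact connIn_mono (by have := mem_doubled.1 hv; omega) (hdouble v hv)
    obtain ⟨m, hm⟩ : ∃ m, wordLen S M v = m + 1 :=
      Nat.exists_eq_succ_of_ne_zero fun h => hv0 (eq_zero_of_wordLen (hr v) h)
    suffices hb : ∃ b ∈ S, b ≠ a ∧ wordLen S M (v - b) ≤ m by
      obtain ⟨b, hb, hba, hl⟩ := hb
      have h := connIn_mono hl (connIn_wordLen (M := M) (v := b) (u := v) (hr _))
      rcases connIn_update_or (insert (a + a) (S.erase a)) (v₀ := 0) h with h | h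
      · rw [hm]
        exact connIn_cons (x := b) (by simp [s', hb, hba]) h
      · have := wordLen_le_of_connIn_zero (M := M) h
        omega
    obtain ⟨b, hb, -, hl⟩ := exists_wordLen_sub (M := M) (hr v) hm
    by_cases hba : b = a
    · subst hba
      have hm0 : m ≠ 0 := fun h => hva <|
        sub_eq_zero.1 (eq_zero_of_wordLen (M := M) (hr (v - b)) (hl.trans h))
      obtain ⟨c, hc, -, hl'⟩ := exists_wordLen_sub (M := M) (m := m - 1) (hr (v - b)) (by omega)
      refine ⟨c, hc, ?_, ?_⟩
      · rintro rfl
        exact hv (mem_doubled.2 (by omega))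
      · have h1 := wordLen_add_le (M := M) (hr (v - b - c)) (hr b)
        have h2 := wordLen_of_mem_le (M := M) hb
        rw [show v - b - c + b = v - c by abel] at h1
        omega
    · exact ⟨b, hb, hba, hl.le⟩
  have hself : distW s' M 0 a ≤ D + 1 := by
    obtain ⟨b, hb, hba⟩ := S.exists_mem_ne (by omega) a
    have hb0 : b ≠ 0 := fun h => hS0 (h ▸ hb)
    have hab : a - b ≠ 0 := sub_ne_zero.2 hba.symm
    have h := hother (a - b) hab (by simpa using hb0)
    refine distW_le M (connIn_snoc (connIn_mono (hmax _) h) ?_)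
    rw [hs', Function.update_of_ne hab, mem_cayley]
    simpa using hb
  have hla : wordLen S M a = 1 := by
    have h1 := wordLen_of_mem_le (M := M) ha
    have h2 : wordLen S M a ≠ 0 := fun h => ha0 (eq_zero_of_wordLen (hr a) h)
    omega
  have hnot : ∀ v ∈ doubled S M a, 2 ≤ wordLen S M v := fun v hv => by
    have := mem_doubled.1 hv
    omega
  have hpt : ∀ u ∈ Finset.univ.filter (fun u : H => u ≠ 0),
      distW s' M 0 u + (if u ∈ doubled S M a then 1 else 0)
        ≤ wordLen S M u + (if u = a then D else 0) := by
    intro u hu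
    have hu0 : u ≠ 0 := by simpa using hu
    by_cases hua : u = a
    · subst hua
      rw [if_neg (fun h => by have := hnot u h; omega), if_pos rfl]
      omega
    · rw [if_neg hua]
      split_ifs with h
      · have := distW_le M (hdouble u h)
        have := mem_doubled.1 h
        omega
      · exact distW_le M (hother u hu0 hua)
  have hsum := Finset.sum_le_sum hpt
  have hG : ∑ u ∈ Finset.univ.filter (fun u : H => u ≠ 0),
      (if u ∈ doubled S M a then 1 else 0) = (doubled S M a).card := by
    rw [← Finset.card_filter]
    congr 1
    ext u
    simp only [Finset.mem_filter, Finset.mem_univ, true_and, and_iff_right_iff_imp]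
    rintro hu rfl
    have := hnot 0 hu
    rw [wordLen_zero] at this
    omega
  rw [Finset.sum_add_distrib, hG, Finset.sum_add_distrib, Finset.sum_ite_eq',
    if_pos (by simpa using ha0)] at hsum
  omega

theorem wordLen_sum_le (hr : ∀ u, Reach S u) (T : Finset H) (hT : T ⊆ S) :
    wordLen S M (∑ x ∈ T, x) ≤ T.card := by
  induction T using Finset.induction_on with
  | empty => simp [wordLen_zero]
  | insert a T haT ih =>
    rw [Finset.sum_insert haT, Finset.card_insert_of_notMem haT]
    have h1 := wordLen_add_le (M := M) (hr a) (hr (∑ x ∈ T, x))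
    have h2 := wordLen_of_mem_le (M := M) (hT (Finset.mem_insert_self a T))
    have h3 := ih ((Finset.subset_insert a T).trans hT)
    omega

/-- A node none of whose shortest representations repeats a generator is a subset sum. -/
theorem exists_subset_sum [Fintype H] (hr : ∀ u, Reach S u) (m : ℕ) (v : H)
    (hm : wordLen S M v = m) (hv : ∀ a ∈ S, v ∉ doubled S M a) :
    ∃ T ⊆ S, T.card = m ∧ ∑ x ∈ T, x = v := by
  induction m generalizing v with
  | zero => exact ⟨∅, by simp, rfl, by simp [eq_zero_of_wordLen (hr v) hm]⟩
  | succ m ih =>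
    obtain ⟨a, ha, -, hl⟩ := exists_wordLen_sub (hr v) hm
    have hla := wordLen_of_mem_le (M := M) ha
    have htri : ∀ b ∈ S, wordLen S M v ≤ wordLen S M (v - b - b) + 2 := fun b hb => by
      have h1 := wordLen_add_le (M := M) (hr (v - b - b)) (hr b)
      have h2 := wordLen_add_le (M := M) (hr (v - b)) (hr b)
      have h3 := wordLen_of_mem_le (M := M) hb
      rw [sub_add_cancel] at h1 h2
      omega
    obtain ⟨T, hT, hTc, hTs⟩ := ih (v - a) hl fun b hb h => by
      refine hv b hb (mem_doubled.2 (le_antisymm ?_ (htri b hb)))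
      rw [mem_doubled] at h
      have h1 := wordLen_add_le (M := M) (hr (v - a - b - b)) (hr a)
      rw [show v - a - b - b + a = v - b - b by abel] at h1
      omega
    have haT : a ∉ T := fun h => by
      refine hv a ha (mem_doubled.2 (le_antisymm ?_ (htri a ha)))
      have h1 := wordLen_sum_le (M := M) hr (T.erase a) ((Finset.erase_subset a T).trans hT)
      have h2 := Finset.add_sum_erase T (fun x => x) h
      have h3 := Finset.card_erase_add_one h
      rw [show ∑ x ∈ T.erase a, x = v - a - a by rw [← hTs, ← h2]; simp] at h1
      omega
    refine ⟨insert a T, Finset.insert_subset ha hT, ?_, ?_⟩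
    · rw [Finset.card_insert_of_notMem haT, hTc]
    · rw [Finset.sum_insert haT, hTs]
      abel

theorem card_le_of_card_doubled_le [Fintype H] (hr : ∀ u, Reach S u) {D : ℕ}
    (hD : ∀ a ∈ S, (doubled S M a).card ≤ D) :
    Fintype.card H ≤ 2 ^ S.card + S.card * D := by
  classical
  have hsub : (Finset.univ : Finset H) ⊆
      S.powerset.image (fun T => ∑ x ∈ T, x) ∪ S.biUnion (doubled S M) := by
    intro v _
    rw [Finset.mem_union, Finset.mem_biUnion, Finset.mem_image]
    by_cases hv : ∃ a ∈ S, v ∈ doubled S M a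
    · exact Or.inr hv
    · push Not at hv
      obtain ⟨T, hT, -, hTs⟩ := exists_subset_sum hr _ v rfl hv
      exact Or.inl ⟨T, Finset.mem_powerset.2 hT, hTs⟩
  have h1 := (Finset.card_le_card hsub).trans (Finset.card_union_le _ _)
  have h2 : (S.powerset.image (fun T => ∑ x ∈ T, x)).card ≤ 2 ^ S.card :=
    Finset.card_image_le.trans (Finset.card_powerset S).le
  have h3 := Finset.card_biUnion_le_card_mul S (doubled S M) D hD
  rw [Finset.card_univ] at h1
  omega

theorem sq_le_two_mul_two_pow (k : ℕ) : k ^ 2 ≤ 2 * 2 ^ k := by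
  induction k with
  | zero => simp
  | succ k ih =>
    rcases Nat.lt_or_ge k 3 with h | h
    · interval_cases k <;> norm_num
    · rw [pow_succ 2 k]
      nlinarith

end Cayley

/-- There is a constant `c > 0` such that for every `k ≥ 2`, every finite
additive abelian group `H` of order at least `c·2^k`, and every connection set
`S ⊆ H \ {0}` of size `k`, the Cayley wiring on `H` with connection set `S` is
not stable for the uniform BDNF game. -/
theorem stmt_2 :
    ∃ c : ℕ, 0 < c ∧
      ∀ k : ℕ, 2 ≤ k →
        ∀ (H : Type) [AddCommGroup H] [Fintype H] [DecidableEq H],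
          c * 2 ^ k ≤ Fintype.card H →
          ∀ S : Finset H, (0 : H) ∉ S → S.card = k →
            ∀ M : ℕ, (Fintype.card H) ^ 2 < M →
              ¬ Stable k M (cayley S) := by
  refine ⟨100, by norm_num, ?_⟩
  intro k hk H _ _ _ hcard S hS0 hSk M hM hst
  have hr := hst.reach hk hS0 hSk hM
  obtain ⟨v, -, hmax⟩ := exists_max_wordLen S M
  have hpos := wordLen_pos_of_max hS0 (Finset.card_pos.1 (by omega)) hmax
  have hmax' := fun u => hmax u (hr u)
  have hsq := hst.sq_wordLen_le hk hr hmax' hpos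
  have hle := card_le_of_card_doubled_le hr fun a ha =>
    hst.card_doubled_le hk hS0 hSk hr hmax' ha
  rw [hSk] at hle
  have hk2 := sq_le_two_mul_two_pow k
  have hN : 0 < 2 ^ k := by positivity
  generalize 2 ^ k = N at *
  generalize wordLen S M v = D at *
  generalize Fintype.card H = n at *
  have h1 : 99 * n ≤ 100 * (k * D) := by omega
  have h2 : (99 * n) ^ 2 ≤ (100 * (k * D)) ^ 2 := Nat.pow_le_pow_left h1 2
  have h3 : k ^ 2 * D ^ 2 ≤ 2 * N * (4 * n) := Nat.mul_le_mul hk2 hsq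
  have h4 : 100 * N * n ≤ n * n := Nat.mul_le_mul_right n hcard
  have h5 : 0 < n * n := by
    have : 0 < n := by omega
    positivity
  nlinarith

end BDNF
end

section
/- For every integer n ≥ 2 and every integer k with k > (n−2)/2, every Cayley wiring on a finite additive abelian group H of order n with connection set S ⊆ H \ {0} of size k is stable for the uniform (n,k)-BDNF game. -/
namespace BDNF

variable {V : Type} [DecidableEq V]

open Finset

lemma distW_le_of_connIn {W : Type} {s : W → Finset W} (M : ℕ) {m : ℕ} {v u : W} (h : connIn s m v u) :
    distW s M v u ≤ m := by
  classical
  have hex : ∃ m, connIn s m v u := ⟨m, h⟩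
  rw [distW, dif_pos hex]
  exact Nat.find_min' hex h

lemma le_distW {W : Type} {s : W → Finset W} {M : ℕ} {m : ℕ} {v u : W} (hM : m ≤ M)
    (h : ∀ l < m, ¬ connIn s l v u) : m ≤ distW s M v u := by
  classical
  rw [distW]
  split_ifs with hex
  · exact (Nat.le_find_iff hex m).2 h
  · exact hM

lemma connIn_one_of_mem_s4 {W : Type} {s : W → Finset W} {v u : W} (h : u ∈ s v) : connIn s 1 v u :=
  Or.inr ⟨u, h, rfl⟩

/-- The nodes other than `v` that are out-neighbors of `v` are at distance at least one, and
the remaining ones are at distance at least two. -/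
lemma two_le_distW_add {s : V → Finset V} {M : ℕ} (hM : 2 ≤ M) {v u : V} (huv : u ≠ v) :
    2 ≤ distW s M v u + if u ∈ s v then 1 else 0 := by
  split_ifs with hu
  · have : 1 ≤ distW s M v u := by
      refine le_distW (by omega) fun l hl => ?_
      obtain rfl : l = 0 := by omega
      exact fun h => huv h.symm
    omega
  · refine le_distW hM fun l hl h => ?_
    interval_cases l
    · exact huv h.symm
    · rcases h with h | ⟨w, hw, h⟩
      · exact huv h.symm
      · exact hu (h ▸ hw)

lemma distW_add_le_two {s : V → Finset V} (M : ℕ) {v u : V} (h : connIn s 2 v u) :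
    distW s M v u + (if u ∈ s v then 1 else 0) ≤ 2 := by
  split_ifs with hu
  · have := distW_le_of_connIn M (connIn_one_of_mem_s4 hu)
    omega
  · exact distW_le_of_connIn M h

lemma cost_add_card [Fintype V] (s : V → Finset V) (M : ℕ) {v : V} (hv : v ∉ s v) :
    cost s M v + (s v).card =
      ∑ u ∈ univ.filter (fun u => u ≠ v), (distW s M v u + if u ∈ s v then 1 else 0) := by
  rw [sum_add_distrib, cost, sum_boole, filter_filter]
  congr 2
  ext u
  simp only [mem_filter, mem_univ, true_and]
  exact ⟨fun h => ⟨fun e => hv (e ▸ h), h⟩, fun h => h.2⟩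

/-- A node that reaches everything within two steps cannot improve without adding links. -/
lemma cost_le_cost_of_connIn_two [Fintype V] {s t : V → Finset V} {M : ℕ} (hM : 2 ≤ M) {v : V}
    (hs : v ∉ s v) (ht : v ∉ t v) (hcard : (t v).card ≤ (s v).card)
    (h : ∀ u, connIn s 2 v u) : cost s M v ≤ cost t M v := by
  have hle : cost s M v + (s v).card ≤ cost t M v + (t v).card := by
    rw [cost_add_card s M hs, cost_add_card t M ht]
    refine sum_le_sum fun u hu => (distW_add_le_two M (h u)).trans (two_le_distW_add hM ?_)
    exact (mem_filter.1 hu).2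
  omega

/-- If a subset of a finite group has more than half of the elements, every element is a sum of
two of its members. -/
lemma exists_add_eq_of_card_lt {H : Type} [AddCommGroup H] [Fintype H] [DecidableEq H]
    {A : Finset H} (hA : Fintype.card H < 2 * A.card) (x : H) : ∃ a ∈ A, ∃ b ∈ A, a + b = x := by
  have hcard : (A.image (fun a => x - a)).card = A.card :=
    card_image_of_injective _ sub_right_injective
  have hinter : (A ∩ A.image (fun a => x - a)).Nonempty :=
    inter_nonempty_of_card_lt_card_add_card (subset_univ A) (subset_univ _)
      (by rw [hcard, card_univ]; omega)
  obtain ⟨a, ha⟩ := hinter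
  obtain ⟨haA, hab⟩ := mem_inter.1 ha
  obtain ⟨b, hb, rfl⟩ := mem_image.1 hab
  exact ⟨_, haA, b, hb, sub_add_cancel x b⟩

lemma connIn_two_cayley {H : Type} [AddCommGroup H] [Fintype H] [DecidableEq H] {S : Finset H}
    (h0 : (0 : H) ∉ S) (hS : Fintype.card H < 2 * (S.card + 1)) (v u : H) :
    connIn (cayley S) 2 v u := by
  have hmem : ∀ w a, a ∈ S → w + a ∈ cayley S w := fun w a ha => mem_image_of_mem _ ha
  obtain ⟨a, ha, b, hb, hab⟩ :=
    exists_add_eq_of_card_lt (A := insert 0 S) (by rwa [card_insert_of_notMem h0]) (u - v)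
  obtain rfl : u = v + a + b := by rw [add_assoc, hab, add_sub_cancel]
  have hone : connIn (cayley S) 1 (v + a) (v + a + b) := by
    rcases mem_insert.1 hb with rfl | hb
    · exact Or.inl (add_zero _).symm
    · exact connIn_one_of_mem_s4 (hmem _ _ hb)
  rcases mem_insert.1 ha with rfl | ha
  · rw [add_zero] at hone ⊢
    rcases mem_insert.1 hb with rfl | hb
    · exact Or.inl (add_zero _).symm
    · exact Or.inr ⟨v + b, hmem _ _ hb, Or.inl rfl⟩
  · exact Or.inr ⟨v + a, hmem _ _ ha, hone⟩

/-- For every `n ≥ 2` and every `k > (n-2)/2` (i.e. `2k > n - 2`), every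
Cayley wiring on a finite additive abelian group of order `n` with a
connection set `S ⊆ H \ {0}` of size `k` is stable for the uniform
`(n,k)`-BDNF game. -/
theorem stmt_4 :
    ∀ n : ℕ, 2 ≤ n → ∀ k : ℕ, n - 2 < 2 * k →
      ∀ (H : Type) [AddCommGroup H] [Fintype H] [DecidableEq H],
        Fintype.card H = n →
        ∀ S : Finset H, (0 : H) ∉ S → S.card = k →
          ∀ M : ℕ, n ^ 2 < M → Stable k M (cayley S) := by
  intro n hn k hk H _ _ _ hH S h0 hS M hM v t hvt ht
  have hself : v ∉ cayley S v := by simpa [cayley] using h0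
  have hcard : (cayley S v).card = k :=
    (card_image_of_injective S (add_right_injective v)).trans hS
  refine cost_le_cost_of_connIn_two (by nlinarith) hself ?_ ?_
    (connIn_two_cayley h0 (by omega) v)
  · rwa [Function.update_self]
  · rwa [Function.update_self, hcard]

end BDNF
end
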